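/- Let Γ be a round tree graph with horizontal branching in [2,H] and vertical branching V ≥ 2, and set Q = 1 + log V / log H. Then for every p with 1 ≤ p < Q there is no constant C > 0 such that Λ^p_Γ(r) ≤ C·(Cr + C)^{1 − 1/p} + C for all r ≥ 1; equivalently, the set { p ∈ [1,∞) : Λ^p_Γ(r) ≲ r^{1−1/p} } is contained in [Q, ∞), so p_Λ(Γ) = inf{ p ≥ 1 : Λ^p_Γ(r) ≲ r^{1−1/p} } ≥ 1 + log V / log H. -/

import Mathlib

open Finset

/-- Vertices of a round tree graph: pairs of a word over `[H] = {0,…,H-1}` and a word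
over `[V] = {0,…,V-1}`. -/
abbrev RTVert (H V : ℕ) := List (Fin H) × List (Fin V)

/-- Strict lexicographic order on words (over `Fin n`). -/
def LexLt {n : ℕ} (w w' : List (Fin n)) : Prop := List.Lex (· < ·) w w'

/-- `Γ` is a round tree graph with vertical branching `V` and horizontal branching in
`[2,H]`, with vertex set `S ⊆ [H]^* × [V]^*`:
(0) `(∅,∅) ∈ S`;
(1) `|h| = |v|` for every `(h,v) ∈ S`;
(2) if `(hα, vβ) ∈ S` then `(h,v) ∈ S` and they are joined by a (vertical) edge;
(3) for `(h,v) ∈ S` and `β ∈ [V]` there is `Δ ∈ [2,H]` with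
    `{α : (hα,vβ) ∈ S} = [Δ]`;
(4) if `(h,v),(h',v) ∈ S` with `h,h'` consecutive in the lexicographic order on
    `{w : (w,v) ∈ S}`, they are joined by a (horizontal) edge;
(5) every edge of `Γ` is vertical or horizontal as above. -/
def IsRoundTreeGraph (H V : ℕ) (S : Set (RTVert H V)) (Γ : SimpleGraph (RTVert H V)) :
    Prop :=
  (([], []) ∈ S) ∧
  (∀ x ∈ S, x.1.length = x.2.length) ∧
  (∀ (h : List (Fin H)) (v : List (Fin V)) (α : Fin H) (β : Fin V),
      (h ++ [α], v ++ [β]) ∈ S → (h, v) ∈ S ∧ Γ.Adj (h, v) (h ++ [α], v ++ [β])) ∧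
  (∀ (h : List (Fin H)) (v : List (Fin V)), (h, v) ∈ S → ∀ β : Fin V,
      ∃ Δ : ℕ, 2 ≤ Δ ∧ Δ ≤ H ∧
        ∀ α : Fin H, ((h ++ [α], v ++ [β]) ∈ S ↔ (α : ℕ) < Δ)) ∧
  (∀ (h h' : List (Fin H)) (v : List (Fin V)),
      (h, v) ∈ S → (h', v) ∈ S → LexLt h h' →
      (¬∃ w, (w, v) ∈ S ∧ LexLt h w ∧ LexLt w h') →
      Γ.Adj (h, v) (h', v)) ∧
  (∀ x y : RTVert H V, Γ.Adj x y → x ∈ S ∧ y ∈ S ∧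
      ((∃ (α : Fin H) (β : Fin V), y = (x.1 ++ [α], x.2 ++ [β])) ∨
       (∃ (α : Fin H) (β : Fin V), x = (y.1 ++ [α], y.2 ++ [β])) ∨
       (x.2 = y.2 ∧
        ((LexLt x.1 y.1 ∧ ¬∃ w, (w, x.2) ∈ S ∧ LexLt x.1 w ∧ LexLt w y.1) ∨
         (LexLt y.1 x.1 ∧ ¬∃ w, (w, x.2) ∈ S ∧ LexLt y.1 w ∧ LexLt w x.1)))))

/-- The `ℓ^p` norm of a function on a finite vertex set. -/
noncomputable def lpNorm {W : Type*} [Fintype W] (p : ℝ) (f : W → ℝ) : ℝ :=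
  (∑ v, |f v| ^ p) ^ (1 / p)

/-- The `ℓ^p` norm of the gradient of `f` on a finite simple graph. -/
noncomputable def gradLpNorm {W : Type*} [Fintype W] (G : SimpleGraph W) (p : ℝ)
    (f : W → ℝ) : ℝ :=
  letI := Classical.decEq W
  letI := Classical.decRel G.Adj
  (∑ e ∈ G.edgeFinset,
    Sym2.lift ⟨fun x y => |f x - f y| ^ p,
      fun x y => by show |f x - f y| ^ p = |f y - f x| ^ p; rw [abs_sub_comm]⟩ e) ^ (1 / p)

/-- The `L^p`-Poincaré constant
`h^p(Y) = inf { ‖∇f‖_p / ‖f‖_p : f : V(Y) → ℝ, ∑ v, f v = 0, f ≢ 0 }`. -/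
noncomputable def poincareConst {W : Type*} [Fintype W] (G : SimpleGraph W) (p : ℝ) : ℝ :=
  sInf { c : ℝ | ∃ f : W → ℝ, (∑ v, f v) = 0 ∧ f ≠ 0 ∧ c = gradLpNorm G p f / lpNorm p f }

/-- The `L^p`-Poincaré profile
`Λ^p_X(r) = sup { |Y| · h^p(Y) : Y a finite subgraph of X, |Y| ≤ r }`. -/
noncomputable def poincareProfile {W : Type*} (X : SimpleGraph W) (p : ℝ) (r : ℝ) : ℝ :=
  sSup { c : ℝ | ∃ (s : Finset W) (G : SimpleGraph s),
    (∀ u v : s, G.Adj u v → X.Adj u v) ∧ (s.card : ℝ) ≤ r ∧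
    c = (s.card : ℝ) * poincareConst G p }


section Analytic

lemma rt_sum_pow_le {α : Type*} (A : Finset α) (N : α → ℝ) (hN : ∀ x, 0 ≤ N x) (p : ℝ)
    (hp : 1 ≤ p) (a : ℕ) (ha : A.card ≤ a) :
    (∑ y ∈ A, N y) ^ p ≤ (a : ℝ) ^ (p - 1) * ∑ y ∈ A, N y ^ p := by
  have h := Real.rpow_sum_le_const_mul_sum_rpow A N hp
  simp only [abs_of_nonneg (hN _)] at h
  refine h.trans ?_
  apply mul_le_mul_of_nonneg_right
  · apply Real.rpow_le_rpow (by positivity) (by exact_mod_cast ha) (by linarith)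
  · exact Finset.sum_nonneg fun y _ => Real.rpow_nonneg (hN y) p

lemma rt_three_pow_le (p : ℝ) (hp : 1 ≤ p) (u v w : ℝ) (hu : 0 ≤ u) (hv : 0 ≤ v) (hw : 0 ≤ w) :
    (u + v + w) ^ p ≤ 3 ^ (p - 1) * (u ^ p + v ^ p + w ^ p) := by
  have h := Real.rpow_sum_le_const_mul_sum_rpow (Finset.univ : Finset (Fin 3)) ![u, v, w] hp
  simpa [Fin.sum_univ_three, abs_of_nonneg hu, abs_of_nonneg hv, abs_of_nonneg hw] using h

lemma rt_two_pow_le (p : ℝ) (hp : 1 ≤ p) (u v : ℝ) (hu : 0 ≤ u) (hv : 0 ≤ v) :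
    (u + v) ^ p ≤ 2 ^ (p - 1) * (u ^ p + v ^ p) := by
  have h := Real.rpow_sum_le_const_mul_sum_rpow (Finset.univ : Finset (Fin 2)) ![u, v] hp
  simpa [Fin.sum_univ_two, abs_of_nonneg hu, abs_of_nonneg hv] using h

/-- double counting -/
lemma rt_double {α : Type*} [DecidableEq α] (s t : Finset α) (A : α → Finset α) (M : α → ℝ)
    (hM : ∀ x, 0 ≤ M x) (hA : ∀ x ∈ t, A x ⊆ s) (k : ℝ)
    (hk : ∀ y ∈ s, ((t.filter fun x => y ∈ A x).card : ℝ) ≤ k) :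
    ∑ x ∈ t, ∑ y ∈ A x, M y ≤ k * ∑ y ∈ s, M y := by
  rw [Finset.sum_comm' (t' := s) (s' := fun y => t.filter fun x => y ∈ A x)]
  · rw [Finset.mul_sum]
    apply Finset.sum_le_sum
    intro y hy
    rw [Finset.sum_const, nsmul_eq_mul]
    exact mul_le_mul_of_nonneg_right (hk y hy) (hM y)
  · intro x y
    simp only [Finset.mem_filter]
    constructor
    · rintro ⟨hx, hy⟩
      exact ⟨⟨hx, hy⟩, hA x hx hy⟩
    · rintro ⟨⟨hx, hy⟩, _⟩
      exact ⟨hx, hy⟩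

lemma rt_core {α : Type*} [DecidableEq α] (s I : Finset α) (F N : α → ℝ) (hN : ∀ x, 0 ≤ N x)
    (hI : I.Nonempty) (A B : α → Finset α) (C : α → α → Finset α) (p : ℝ) (hp : 1 ≤ p)
    (a b : ℕ) (ha0 : 1 ≤ a) (hb0 : 1 ≤ b)
    (hA : ∀ x ∈ s, A x ⊆ s) (hB : ∀ x ∈ s, B x ⊆ s) (hC : ∀ x ∈ s, ∀ i ∈ I, C x i ⊆ s)
    (hAc : ∀ x ∈ s, (A x).card ≤ a) (hBc : ∀ x ∈ s, (B x).card ≤ b)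
    (hCc : ∀ x ∈ s, ∀ i ∈ I, (C x i).card ≤ a)
    (hAm : ∀ y ∈ s, (s.filter fun x => y ∈ A x).card ≤ a)
    (hBm : ∀ y ∈ s, (s.filter fun x => y ∈ B x).card ≤ a * b)
    (hCm : ∀ x ∈ s, ∀ y ∈ s, (I.filter fun i => y ∈ C x i).card ≤ 1)
    (hF : ∀ x ∈ s, ∀ i ∈ I, |F x - F i| ≤ ∑ y ∈ A x, N y + ∑ y ∈ B x, N y + ∑ y ∈ C x i, N y) :
    ∃ c : ℝ, ∑ x ∈ s, |F x - c| ^ p ≤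
      3 ^ (p - 1) * ((a : ℝ) ^ p + a * (b : ℝ) ^ p + (a : ℝ) ^ (p - 1) * (s.card / I.card)) *
        ∑ y ∈ s, N y ^ p := by
  have hIc : (0 : ℝ) < I.card := by exact_mod_cast hI.card_pos
  have haR : (0 : ℝ) < a := by exact_mod_cast ha0
  have hbR : (0 : ℝ) < b := by exact_mod_cast hb0
  have hM : ∀ x, 0 ≤ N x ^ p := fun x => Real.rpow_nonneg (hN x) p
  set S := ∑ y ∈ s, N y ^ p with hS
  have hS0 : 0 ≤ S := Finset.sum_nonneg fun y _ => hM y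
  have hns : ∀ t : Finset α, 0 ≤ ∑ y ∈ t, N y := fun t => Finset.sum_nonneg fun y _ => hN y
  refine ⟨∑ i ∈ I, (I.card : ℝ)⁻¹ * F i, ?_⟩
  have hw1 : ∑ i ∈ I, (I.card : ℝ)⁻¹ = 1 := by
    rw [Finset.sum_const, nsmul_eq_mul, mul_inv_cancel₀ hIc.ne']
  -- pointwise
  have h1 : ∀ x ∈ s, |F x - ∑ i ∈ I, (I.card : ℝ)⁻¹ * F i| ^ p ≤
      3 ^ (p - 1) * ((a : ℝ) ^ (p - 1) * ∑ y ∈ A x, N y ^ p + (b : ℝ) ^ (p - 1) * ∑ y ∈ B x, N y ^ p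
        + (a : ℝ) ^ (p - 1) * ((I.card : ℝ)⁻¹ * S)) := by
    intro x hx
    have e1 : F x - ∑ i ∈ I, (I.card : ℝ)⁻¹ * F i = ∑ i ∈ I, (I.card : ℝ)⁻¹ * (F x - F i) := by
      simp only [mul_sub, Finset.sum_sub_distrib]
      rw [← Finset.sum_mul, hw1, one_mul]
    have e2 : |F x - ∑ i ∈ I, (I.card : ℝ)⁻¹ * F i| ≤ ∑ i ∈ I, (I.card : ℝ)⁻¹ * |F x - F i| := by
      rw [e1]
      refine (Finset.abs_sum_le_sum_abs _ _).trans (le_of_eq ?_)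
      refine Finset.sum_congr rfl fun i _ => ?_
      rw [abs_mul, abs_of_pos (inv_pos.2 hIc)]
    have e3 : |F x - ∑ i ∈ I, (I.card : ℝ)⁻¹ * F i| ^ p ≤
        ∑ i ∈ I, (I.card : ℝ)⁻¹ * |F x - F i| ^ p :=
      (Real.rpow_le_rpow (abs_nonneg _) e2 (by linarith)).trans
        (Real.rpow_arith_mean_le_arith_mean_rpow I _ _ (fun i _ => (inv_pos.2 hIc).le) hw1
          (fun i _ => abs_nonneg _) hp)
    refine e3.trans ?_
    have e4 : ∀ i ∈ I, |F x - F i| ^ p ≤ 3 ^ (p - 1) * ((a : ℝ) ^ (p - 1) * ∑ y ∈ A x, N y ^ p +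
        (b : ℝ) ^ (p - 1) * ∑ y ∈ B x, N y ^ p + (a : ℝ) ^ (p - 1) * ∑ y ∈ C x i, N y ^ p) := by
      intro i hi
      refine (Real.rpow_le_rpow (abs_nonneg _) (hF x hx i hi) (by linarith)).trans ?_
      refine (rt_three_pow_le p hp _ _ _ (hns _) (hns _) (hns _)).trans ?_
      have q1 := rt_sum_pow_le (A x) N hN p hp a (hAc x hx)
      have q2 := rt_sum_pow_le (B x) N hN p hp b (hBc x hx)
      have q3 := rt_sum_pow_le (C x i) N hN p hp a (hCc x hx i hi)
      gcongr
    have e5 : ∑ i ∈ I, ∑ y ∈ C x i, N y ^ p ≤ 1 * S := by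
      refine rt_double s I (C x) (fun y => N y ^ p) hM (hC x hx) 1 ?_
      intro y hy
      exact_mod_cast hCm x hx y hy
    calc ∑ i ∈ I, (I.card : ℝ)⁻¹ * |F x - F i| ^ p
        ≤ ∑ i ∈ I, (I.card : ℝ)⁻¹ * (3 ^ (p - 1) * ((a : ℝ) ^ (p - 1) * ∑ y ∈ A x, N y ^ p +
        (b : ℝ) ^ (p - 1) * ∑ y ∈ B x, N y ^ p + (a : ℝ) ^ (p - 1) * ∑ y ∈ C x i, N y ^ p)) :=
          Finset.sum_le_sum fun i hi =>
            mul_le_mul_of_nonneg_left (e4 i hi) (inv_pos.2 hIc).le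
      _ = 3 ^ (p - 1) * ((a : ℝ) ^ (p - 1) * ∑ y ∈ A x, N y ^ p +
            (b : ℝ) ^ (p - 1) * ∑ y ∈ B x, N y ^ p +
            (a : ℝ) ^ (p - 1) * ((I.card : ℝ)⁻¹ * ∑ i ∈ I, ∑ y ∈ C x i, N y ^ p)) := by
          rw [← Finset.mul_sum, ← Finset.mul_sum, Finset.sum_add_distrib, ← Finset.mul_sum,
            Finset.sum_const, nsmul_eq_mul]
          field_simp
      _ ≤ _ := by
          rw [one_mul] at e5
          gcongr
  refine (Finset.sum_le_sum h1).trans ?_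
  rw [← Finset.mul_sum, Finset.sum_add_distrib, Finset.sum_add_distrib, ← Finset.mul_sum,
    ← Finset.mul_sum, Finset.sum_const, nsmul_eq_mul, mul_assoc]
  have d1 : ∑ x ∈ s, ∑ y ∈ A x, N y ^ p ≤ a * S :=
    rt_double s s A (fun y => N y ^ p) hM hA a (fun y hy => by exact_mod_cast hAm y hy)
  have d2 : ∑ x ∈ s, ∑ y ∈ B x, N y ^ p ≤ (a * b) * S :=
    rt_double s s B (fun y => N y ^ p) hM hB (a * b) (fun y hy => by exact_mod_cast hBm y hy)
  have p1 : (a : ℝ) ^ p = (a : ℝ) ^ (p - 1) * a := by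
    rw [← Real.rpow_add_one haR.ne']; simp
  have p2 : (b : ℝ) ^ p = (b : ℝ) ^ (p - 1) * b := by
    rw [← Real.rpow_add_one hbR.ne']; simp
  refine mul_le_mul_of_nonneg_left ?_ (by positivity)
  calc _ ≤ (a : ℝ) ^ (p - 1) * (a * S) + (b : ℝ) ^ (p - 1) * ((a * b) * S) +
        s.card * ((a : ℝ) ^ (p - 1) * ((I.card : ℝ)⁻¹ * S)) := by gcongr
    _ = _ := by
      rw [p1, p2]; ring

lemma rt_edge_sum {W : Type*} [Fintype W] [DecidableEq W] (G : SimpleGraph W)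
    [DecidableRel G.Adj] (g : Sym2 W → ℝ) (hg : ∀ e, 0 ≤ g e)
    (E : Finset (Sym2 W)) (hE : ∀ e, e ∈ E ↔ e ∈ G.edgeSet) :
    ∑ x, ∑ y ∈ Finset.univ.filter (fun y => G.Adj x y), g s(x, y) ≤ 2 * ∑ e ∈ E, g e := by
  rw [Finset.sum_sigma', ← Finset.sum_fiberwise_of_maps_to (g := fun q : (_ : W) × W => s(q.1, q.2))
    (t := E), Finset.mul_sum]
  swap
  · intro q hq
    rw [hE]
    simpa using hq
  apply Finset.sum_le_sum
  intro e he
  induction e using Sym2.ind with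
  | _ x y =>
  have : ((Finset.univ.sigma fun x : W => Finset.univ.filter fun y => G.Adj x y).filter
      fun q => s(q.1, q.2) = s(x, y)) ⊆ {⟨x, y⟩, ⟨y, x⟩} := by
    rintro ⟨u, v⟩ hq
    simp only [Finset.mem_filter, Sym2.eq_iff] at hq
    rcases hq.2 with ⟨rfl, rfl⟩ | ⟨rfl, rfl⟩ <;> simp
  refine (Finset.sum_le_sum_of_subset_of_nonneg this (fun _ _ _ => hg _)).trans ?_
  refine (Finset.sum_le_card_nsmul _ _ (g s(x, y)) ?_).trans ?_
  · intro q hq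
    simp only [Finset.mem_insert, Finset.mem_singleton] at hq
    rcases hq with rfl | rfl
    · exact le_rfl
    · rw [Sym2.eq_swap]
  · rw [nsmul_eq_mul]
    refine mul_le_mul_of_nonneg_right ?_ (hg _)
    exact_mod_cast Finset.card_le_two

/-- the edge function in `gradLpNorm` -/
noncomputable def rtEdge {W : Type*} (p : ℝ) (f : W → ℝ) : Sym2 W → ℝ :=
  Sym2.lift ⟨fun x y => |f x - f y| ^ p, fun x y => by
    show |f x - f y| ^ p = |f y - f x| ^ p
    rw [abs_sub_comm]⟩

lemma rtEdge_nonneg {W : Type*} (p : ℝ) (f : W → ℝ) (e : Sym2 W) : 0 ≤ rtEdge p f e := by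
  induction e using Sym2.ind with
  | _ x y => simp only [rtEdge, Sym2.lift_mk]; positivity

lemma rt_grad_pow {W : Type*} [Fintype W] (G : SimpleGraph W) (p : ℝ) (hp : 1 ≤ p)
    (f : W → ℝ) : ∃ E : Finset (Sym2 W), (∀ e, e ∈ E ↔ e ∈ G.edgeSet) ∧ 
      gradLpNorm G p f ^ p = ∑ e ∈ E, rtEdge p f e := by
  classical
  let _ := Classical.decEq W
  let _ := Classical.decRel G.Adj
  refine ⟨G.edgeFinset, fun e => SimpleGraph.mem_edgeFinset, ?_⟩
  have : gradLpNorm G p f = (∑ e ∈ G.edgeFinset, rtEdge p f e) ^ (1 / p) := rfl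
  rw [this, ← Real.rpow_mul (Finset.sum_nonneg fun e _ => rtEdge_nonneg p f e), one_div,
    inv_mul_cancel₀ (by linarith), Real.rpow_one]

lemma rt_grad_nonneg {W : Type*} [Fintype W] (G : SimpleGraph W) (p : ℝ) (f : W → ℝ) :
    0 ≤ gradLpNorm G p f := by
  classical
  unfold gradLpNorm
  exact Real.rpow_nonneg (Finset.sum_nonneg fun e _ => rtEdge_nonneg p f e) _

/-- sum over ordered adjacent pairs is at most twice the gradient. -/
lemma rt_grad {W : Type*} [Fintype W] (G : SimpleGraph W) [DecidableRel G.Adj] (p : ℝ)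
    (hp : 1 ≤ p) (f : W → ℝ) :
    ∑ x, ∑ y ∈ Finset.univ.filter (fun y => G.Adj x y), |f x - f y| ^ p ≤
      2 * gradLpNorm G p f ^ p := by
  classical
  obtain ⟨E, hE, h⟩ := rt_grad_pow G p hp f
  rw [h]
  exact rt_edge_sum G (rtEdge p f) (rtEdge_nonneg p f) E hE

/-- crude upper bound for the Poincaré constant. -/
lemma rt_const_le {W : Type*} [Fintype W] (G : SimpleGraph W) (p : ℝ) (hp : 1 ≤ p) :
    poincareConst G p ≤ 2 * ((Fintype.card (Sym2 W) : ℝ) + 1) := by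
  classical
  have hp0 : 0 < p := by linarith
  unfold poincareConst
  rcases Set.eq_empty_or_nonempty { c : ℝ | ∃ f : W → ℝ, (∑ v, f v) = 0 ∧ f ≠ 0 ∧
    c = gradLpNorm G p f / lpNorm p f } with h0 | ⟨c, f, hf, hf0, rfl⟩
  · rw [h0, Real.sInf_empty]
    positivity
  · have hbdd : BddBelow { c : ℝ | ∃ f : W → ℝ, (∑ v, f v) = 0 ∧ f ≠ 0 ∧
        c = gradLpNorm G p f / lpNorm p f } := by
      refine ⟨0, ?_⟩
      rintro c ⟨f, -, -, rfl⟩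
      refine div_nonneg (rt_grad_nonneg G p f) (Real.rpow_nonneg ?_ _)
      exact Finset.sum_nonneg fun _ _ => by positivity
    refine (csInf_le hbdd ⟨f, hf, hf0, rfl⟩).trans ?_
    have hpos : 0 < ∑ v, |f v| ^ p := by
      obtain ⟨v, hv⟩ := Function.ne_iff.1 hf0
      refine Finset.sum_pos' (fun _ _ => by positivity) ⟨v, Finset.mem_univ v, ?_⟩
      exact Real.rpow_pos_of_pos (abs_pos.2 hv) p
    have hl : 0 < lpNorm p f := Real.rpow_pos_of_pos hpos _
    have hlp : ∀ v, |f v| ≤ lpNorm p f := by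
      intro v
      have h1 : |f v| ^ p ≤ ∑ v, |f v| ^ p :=
        Finset.single_le_sum (f := fun v => |f v| ^ p) (fun _ _ => by positivity)
          (Finset.mem_univ v)
      have h2 := Real.rpow_le_rpow (by positivity) h1 (by positivity : 0 ≤ 1 / p)
      rwa [← Real.rpow_mul (abs_nonneg _), mul_one_div_cancel hp0.ne', Real.rpow_one] at h2
    rw [div_le_iff₀ hl]
    obtain ⟨E, hE, h⟩ := rt_grad_pow G p hp f
    have h3 : gradLpNorm G p f ^ p ≤ (((Fintype.card (Sym2 W) : ℝ) + 1) * (2 * lpNorm p f)) ^ p := by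
      rw [h]
      refine (Finset.sum_le_card_nsmul E _ ((2 * lpNorm p f) ^ p) ?_).trans ?_
      · intro e _
        induction e using Sym2.ind with
        | _ x y =>
          simp only [rtEdge, Sym2.lift_mk]
          refine Real.rpow_le_rpow (abs_nonneg _) ?_ hp0.le
          have := abs_sub (f x) (f y)
          linarith [hlp x, hlp y]
      · rw [nsmul_eq_mul, Real.mul_rpow (by positivity : (0 : ℝ) ≤ (Fintype.card (Sym2 W) : ℝ) + 1)
          (by positivity)]
        have hl2 : 0 ≤ (2 * lpNorm p f) ^ p := Real.rpow_nonneg (by linarith) p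
        refine mul_le_mul_of_nonneg_right ?_ hl2
        have h4 : (E.card : ℝ) ≤ (Fintype.card (Sym2 W) : ℝ) + 1 := by
          have := Finset.card_le_univ E
          have : (E.card : ℝ) ≤ Fintype.card (Sym2 W) := by exact_mod_cast this
          linarith
        refine h4.trans ?_
        apply Real.self_le_rpow_of_one_le _ hp
        linarith [(Nat.cast_nonneg (Fintype.card (Sym2 W)) : (0 : ℝ) ≤ _)]
    have h5 := (Real.rpow_le_rpow_iff (rt_grad_nonneg G p f) (by positivity) hp0).1 h3
    linarith

/-- zero mean functions. -/
lemma rt_zero_mean {W : Type*} [Fintype W] (f : W → ℝ) (hf : ∑ v, f v = 0) (p : ℝ) (hp : 1 ≤ p)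
    (c : ℝ) : ∑ v, |f v| ^ p ≤ 2 ^ p * ∑ v, |f v - c| ^ p := by
  have hp0 : 0 < p := by linarith
  have h1 : (Fintype.card W : ℝ) * |c| ^ p ≤ ∑ v, |f v - c| ^ p := by
    rcases isEmpty_or_nonempty W with hW | hW
    · simp
    have hc : (0 : ℝ) < Fintype.card W := by exact_mod_cast Fintype.card_pos
    have e : (Fintype.card W : ℝ) * |c| ≤ ∑ v, |f v - c| := by
      have : ∑ v, (f v - c) = - (Fintype.card W * c) := by
        simp [Finset.sum_sub_distrib, hf]
      have h2 := Finset.abs_sum_le_sum_abs (fun v => f v - c) Finset.univ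
      rw [this, abs_neg, abs_mul, abs_of_pos hc] at h2
      exact h2
    have e2 := rt_sum_pow_le Finset.univ (fun v => |f v - c|) (fun _ => abs_nonneg _) p hp
      (Fintype.card W) le_rfl
    have e3 := (Real.rpow_le_rpow (by positivity) e hp0.le).trans e2
    rw [Real.mul_rpow hc.le (abs_nonneg _)] at e3
    have p1 : (Fintype.card W : ℝ) ^ p = (Fintype.card W : ℝ) ^ (p - 1) * Fintype.card W := by
      rw [← Real.rpow_add_one hc.ne']; simp
    rw [p1, mul_assoc] at e3
    exact le_of_mul_le_mul_left e3 (by positivity)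
  have h2 : ∀ v, |f v| ^ p ≤ 2 ^ (p - 1) * (|f v - c| ^ p + |c| ^ p) := by
    intro v
    refine (Real.rpow_le_rpow (abs_nonneg _) ?_ hp0.le).trans
      (rt_two_pow_le p hp _ _ (abs_nonneg _) (abs_nonneg _))
    have := abs_add_le (f v - c) c
    simpa using this
  refine (Finset.sum_le_sum fun v _ => h2 v).trans ?_
  rw [← Finset.mul_sum, Finset.sum_add_distrib, Finset.sum_const, nsmul_eq_mul, Finset.card_univ]
  have p1 : (2 : ℝ) ^ p = (2 : ℝ) ^ (p - 1) * 2 := by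
    rw [← Real.rpow_add_one (by norm_num)]; simp
  rw [p1, mul_assoc]
  refine mul_le_mul_of_nonneg_left ?_ (by positivity)
  linarith

/-- consequence of a Poincaré inequality for the constant -/
lemma rt_const_ge {W : Type*} [Fintype W] (G : SimpleGraph W) (p : ℝ) (hp : 1 ≤ p) (K : ℝ)
    (hK : 0 < K) (hW : 1 < Fintype.card W)
    (h : ∀ f : W → ℝ, ∑ v, f v = 0 → ∑ v, |f v| ^ p ≤ K * gradLpNorm G p f ^ p) :
    (K ^ (1 / p))⁻¹ ≤ poincareConst G p := by
  classical
  have hp0 : 0 < p := by linarith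
  apply le_csInf
  · obtain ⟨x, y, hxy⟩ := Fintype.exists_pair_of_one_lt_card hW
    refine ⟨_, fun z => if z = x then 1 else if z = y then -1 else 0, ?_, ?_, rfl⟩
    · rw [← Finset.add_sum_erase _ _ (Finset.mem_univ x),
        ← Finset.add_sum_erase _ _ (Finset.mem_erase.2 ⟨hxy.symm, Finset.mem_univ y⟩)]
      rw [Finset.sum_eq_zero]
      · simp [hxy.symm]
      · intro z hz
        simp only [Finset.mem_erase] at hz
        simp [hz.1, hz.2.1]
    · intro h0
      have := congrFun h0 x
      simp at this
  · rintro c ⟨f, hf, hf0, rfl⟩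
    have hg := rt_grad_nonneg G p f
    have hpos : 0 < ∑ v, |f v| ^ p := by
      obtain ⟨v, hv⟩ := Function.ne_iff.1 hf0
      refine Finset.sum_pos' (fun _ _ => by positivity) ⟨v, Finset.mem_univ v, ?_⟩
      exact Real.rpow_pos_of_pos (abs_pos.2 hv) p
    have hl : 0 < lpNorm p f := Real.rpow_pos_of_pos hpos _
    have h1 : lpNorm p f ≤ K ^ (1 / p) * gradLpNorm G p f := by
      have := Real.rpow_le_rpow hpos.le (h f hf) (by positivity : 0 ≤ 1 / p)
      rw [Real.mul_rpow hK.le (by positivity), ← Real.rpow_mul hg, mul_one_div_cancel hp0.ne',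
        Real.rpow_one] at this
      exact this
    rw [le_div_iff₀ hl, inv_mul_le_iff₀ (by positivity)]
    exact h1

lemma rt_le_profile {W : Type*} (X : SimpleGraph W) (p : ℝ) (hp : 1 ≤ p) (s : Finset W)
    (G : SimpleGraph s) (hG : ∀ u v : s, G.Adj u v → X.Adj u v) :
    (s.card : ℝ) * poincareConst G p ≤ poincareProfile X p s.card := by
  apply le_csSup
  · refine ⟨(s.card : ℝ) * (2 * (((s.card : ℝ) + 1) ^ 2 + 1)), ?_⟩
    rintro c ⟨t, G', -, ht, rfl⟩
    have h1 := rt_const_le G' p hp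
    have h2 : (Fintype.card (Sym2 t) : ℝ) ≤ ((t.card : ℝ) + 1) ^ 2 := by
      have : Fintype.card (Sym2 t) ≤ (t.card + 1) ^ 2 := by
        rw [Sym2.card, Fintype.card_coe]
        exact Nat.choose_le_pow _ _
      exact_mod_cast this
    have h3 : poincareConst G' p ≤ 2 * (((s.card : ℝ) + 1) ^ 2 + 1) := by
      refine h1.trans ?_
      have : ((t.card : ℝ) + 1) ^ 2 ≤ ((s.card : ℝ) + 1) ^ 2 := by gcongr
      linarith
    calc _ ≤ (t.card : ℝ) * (2 * (((s.card : ℝ) + 1) ^ 2 + 1)) := by gcongr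
      _ ≤ _ := by gcongr
  · exact ⟨s, G, hG, le_rfl, rfl⟩

/-- The main analytic criterion: canonical paths imply `|s| ≤ const * K`
 if the profile is dominated. -/
lemma rt_profile_bound {α : Type*} [DecidableEq α] (Γ : SimpleGraph α) (p : ℝ) (hp : 1 ≤ p)
    (C₀ : ℝ) (hC₀ : 0 < C₀)
    (hdom : ∀ r : ℝ, 1 ≤ r → poincareProfile Γ p r ≤ C₀ * (C₀ * r + C₀) ^ (1 - 1 / p) + C₀)
    (s : Finset α) (hs : 1 < s.card) (K : ℝ) (hK : 0 < K)
    (h : ∀ F N : α → ℝ, (∀ x, 0 ≤ N x) →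
      (∀ x ∈ s, ∀ y ∈ s, Γ.Adj x y → |F x - F y| ≤ N x) →
      ∃ c : ℝ, ∑ x ∈ s, |F x - c| ^ p ≤ K * ∑ y ∈ s, N y ^ p) :
    (s.card : ℝ) ≤ (2 ^ p * 2) * (C₀ * (2 * C₀) ^ (1 - 1 / p) + C₀) ^ p * K := by
  classical
  have hp0 : 0 < p := by linarith
  have hs0 : (1 : ℝ) < s.card := by exact_mod_cast hs
  let G : SimpleGraph s := Γ.comap Subtype.val
  have hK' : 0 < 2 ^ p * 2 * K := by positivity
  have key : ∀ f : s → ℝ, ∑ v, f v = 0 →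
      ∑ v, |f v| ^ p ≤ (2 ^ p * 2 * K) * gradLpNorm G p f ^ p := by
    intro f hf
    let F : α → ℝ := fun x => if hx : x ∈ s then f ⟨x, hx⟩ else 0
    have hFf : ∀ x : s, F x = f x := fun x => by simp [F]
    let M : α → ℝ := fun x => ∑ y ∈ s.filter (fun y => Γ.Adj x y), |F x - F y| ^ p
    have hM : ∀ x, 0 ≤ M x := fun x => Finset.sum_nonneg fun _ _ => by positivity
    obtain ⟨c, hc⟩ := h F (fun x => M x ^ (1 / p)) (fun x => Real.rpow_nonneg (hM x) _) (by
      intro x hx y hy hxy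
      have h1 : |F x - F y| ^ p ≤ M x :=
        Finset.single_le_sum (f := fun y => |F x - F y| ^ p) (fun _ _ => by positivity)
          (Finset.mem_filter.2 ⟨hy, hxy⟩)
      have h2 := Real.rpow_le_rpow (by positivity) h1 (by positivity : 0 ≤ 1 / p)
      rwa [← Real.rpow_mul (abs_nonneg _), mul_one_div_cancel hp0.ne', Real.rpow_one] at h2)
    have h3 : ∑ y ∈ s, (M y ^ (1 / p)) ^ p ≤ 2 * gradLpNorm G p f ^ p := by
      refine le_of_eq_of_le ?_ (rt_grad G p hp f)
      rw [← Finset.sum_coe_sort s]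
      refine Finset.sum_congr rfl fun x _ => ?_
      rw [← Real.rpow_mul (hM _), one_div, inv_mul_cancel₀ hp0.ne', Real.rpow_one]
      simp only [M, Finset.sum_filter]
      rw [← Finset.sum_coe_sort s]
      refine Finset.sum_congr rfl fun y _ => ?_
      simp only [hFf]
      rfl
    have h4 : ∑ x ∈ s, |F x - c| ^ p = ∑ x, |f x - c| ^ p := by
      rw [← Finset.sum_coe_sort s]
      simp only [hFf]
    rw [h4] at hc
    refine (rt_zero_mean f hf p hp c).trans ?_
    calc _ ≤ 2 ^ p * (K * (2 * gradLpNorm G p f ^ p)) := by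
          refine mul_le_mul_of_nonneg_left (hc.trans ?_) (by positivity)
          exact mul_le_mul_of_nonneg_left h3 hK.le
      _ = _ := by ring
  have h1 := rt_const_ge G p hp _ hK' (by simpa using hs) key
  have h2 := rt_le_profile Γ p hp s G (fun u v h => h)
  have h3 := hdom s.card hs0.le
  set n : ℝ := (s.card : ℝ) with hn
  have hn0 : 0 < n := by linarith
  have he : 0 ≤ 1 - 1 / p := by
    rw [sub_nonneg, div_le_one hp0]; exact hp
  have h4 : C₀ * (C₀ * n + C₀) ^ (1 - 1 / p) + C₀ ≤
      (C₀ * (2 * C₀) ^ (1 - 1 / p) + C₀) * n ^ (1 - 1 / p) := by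
    have e1 : (C₀ * n + C₀) ^ (1 - 1 / p) ≤ (2 * C₀) ^ (1 - 1 / p) * n ^ (1 - 1 / p) := by
      rw [← Real.mul_rpow (by positivity) hn0.le]
      refine Real.rpow_le_rpow (by positivity) ?_ he
      nlinarith
    have e2 : 1 ≤ n ^ (1 - 1 / p) := Real.one_le_rpow hs0.le he
    have e3 := mul_le_mul_of_nonneg_left e1 hC₀.le
    have e4 := mul_le_mul_of_nonneg_left e2 hC₀.le
    linarith
  set D := C₀ * (2 * C₀) ^ (1 - 1 / p) + C₀ with hD
  have hD0 : 0 < D := by positivity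
  have h5 : n * ((2 ^ p * 2 * K) ^ (1 / p))⁻¹ ≤ D * n ^ (1 - 1 / p) :=
    (mul_le_mul_of_nonneg_left h1 hn0.le).trans (h2.trans (h3.trans h4))
  have h6 : n ^ (1 / p) * n ^ (1 - 1 / p) = n := by
    rw [← Real.rpow_add hn0]; simp
  have h7 : n ^ (1 / p) ≤ D * (2 ^ p * 2 * K) ^ (1 / p) := by
    rw [← div_eq_mul_inv, div_le_iff₀ (by positivity)] at h5
    have hq : 0 < n ^ (1 - 1 / p) := by positivity
    refine le_of_mul_le_mul_right ?_ hq
    rw [h6]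
    linarith
  have h8 := Real.rpow_le_rpow (by positivity) h7 hp0.le
  rw [← Real.rpow_mul hn0.le, Real.mul_rpow hD0.le (by positivity), ← Real.rpow_mul hK'.le,
    one_div, inv_mul_cancel₀ hp0.ne', Real.rpow_one, Real.rpow_one] at h8
  linarith

end Analytic

section Comb

/-- the facts about round trees which are used -/
structure RTF {H V : ℕ} (S : Set (RTVert H V)) (Γ : SimpleGraph (RTVert H V)) (z o : Fin H) :
    Prop where
  root : (([], []) : RTVert H V) ∈ S
  len : ∀ h v, (h, v) ∈ S → h.length = v.length
  par : ∀ h v α β, (h ++ [α], v ++ [β]) ∈ S → (h, v) ∈ S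
  adj : ∀ h v α β, (h ++ [α], v ++ [β]) ∈ S → Γ.Adj (h, v) (h ++ [α], v ++ [β])
  chz : ∀ h v β, (h, v) ∈ S → (h ++ [z], v ++ [β]) ∈ S
  cho : ∀ h v β, (h, v) ∈ S → (h ++ [o], v ++ [β]) ∈ S
  zo : z ≠ o
  hor : ∀ (h h' : List (Fin H)) (v : List (Fin V)),
      (h, v) ∈ S → (h', v) ∈ S → h < h' →
      (¬∃ w, (w, v) ∈ S ∧ h < w ∧ w < h') → Γ.Adj (h, v) (h', v)

lemma rtf_of {H V : ℕ} (hH : 2 ≤ H) (S : Set (RTVert H V)) (Γ : SimpleGraph (RTVert H V))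
    (hΓ : IsRoundTreeGraph H V S Γ) : RTF S Γ ⟨0, by omega⟩ ⟨1, by omega⟩ := by
  obtain ⟨h0, h1, h2, h3, h4, h5⟩ := hΓ
  refine ⟨h0, fun h v hx => h1 _ hx, fun h v α β hx => (h2 h v α β hx).1,
    fun h v α β hx => (h2 h v α β hx).2, ?_, ?_, ?_, ?_⟩
  · intro h v β hx
    obtain ⟨Δ, hΔ, -, hh⟩ := h3 h v hx β
    exact (hh _).2 (by simp; omega)
  · intro h v β hx
    obtain ⟨Δ, hΔ, -, hh⟩ := h3 h v hx β
    exact (hh _).2 (by simp; omega)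
  · simp [Fin.ext_iff]
  · intro h h' v hx hx' hlt hno
    exact h4 h h' v hx hx' hlt hno

variable {H V : ℕ} {S : Set (RTVert H V)} {Γ : SimpleGraph (RTVert H V)} {z o : Fin H}

open Classical in
/-- horizontal path above `v` -/
noncomputable def rtP (S : Set (RTVert H V)) (v : List (Fin V)) : Finset (List (Fin H)) :=
  ((List.finite_length_le (Fin H) v.length).toFinset).filter fun h => (h, v) ∈ S

lemma mem_rtP (hR : RTF S Γ z o) {v : List (Fin V)} {h : List (Fin H)} :
    h ∈ rtP S v ↔ (h, v) ∈ S := by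
  unfold rtP
  simp only [Finset.mem_filter, Set.Finite.mem_toFinset, Set.mem_ofPred_eq, and_iff_right_iff_imp]
  intro hx
  exact (hR.len _ _ hx).le

lemma rt_snoc (hR : RTF S Γ z o) {h : List (Fin H)} {v : List (Fin V)} {β : Fin V}
    (hx : (h, v ++ [β]) ∈ S) : ∃ h' α, h = h' ++ [α] := by
  have := hR.len _ _ hx
  rcases List.eq_nil_or_concat h with rfl | ⟨h', α, rfl⟩
  · simp at this
  · exact ⟨h', α, by simp⟩

lemma rtP_nil (hR : RTF S Γ z o) : (rtP S []).card = 1 := by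
  rw [Finset.card_eq_one]
  refine ⟨[], ?_⟩
  ext h
  rw [mem_rtP hR, Finset.mem_singleton]
  constructor
  · intro hx
    exact List.length_eq_zero_iff.1 (hR.len _ _ hx)
  · rintro rfl
    exact hR.root

lemma rtP_snoc_le (hR : RTF S Γ z o) (v : List (Fin V)) (β : Fin V) :
    (rtP S (v ++ [β])).card ≤ (rtP S v).card * H := by
  classical
  have : rtP S (v ++ [β]) ⊆ (rtP S v ×ˢ (Finset.univ : Finset (Fin H))).image
      fun q => q.1 ++ [q.2] := by
    intro h hx
    rw [mem_rtP hR] at hx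
    obtain ⟨h', α, rfl⟩ := rt_snoc hR hx
    rw [Finset.mem_image]
    exact ⟨(h', α), by simp [mem_rtP hR, hR.par _ _ _ _ hx], rfl⟩
  refine (Finset.card_le_card this).trans (Finset.card_image_le.trans ?_)
  simp

lemma rtP_snoc_ge (hR : RTF S Γ z o) (v : List (Fin V)) (β : Fin V) :
    (rtP S v).card * 2 ≤ (rtP S (v ++ [β])).card := by
  classical
  have h2 : ({z, o} : Finset (Fin H)).card = 2 := Finset.card_pair hR.zo
  rw [← h2, ← Finset.card_product]
  apply Finset.card_le_card_of_injOn (fun q => q.1 ++ [q.2])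
  · rintro ⟨h, α⟩ hq
    simp only [Finset.coe_product, Set.mem_prod, Finset.mem_coe, mem_rtP hR, Finset.mem_insert,
      Finset.mem_singleton] at hq
    simp only [Finset.mem_coe, mem_rtP hR]
    rcases hq with ⟨hq, rfl | rfl⟩
    · exact hR.chz _ _ _ hq
    · exact hR.cho _ _ _ hq
  · rintro ⟨h, α⟩ - ⟨h', α'⟩ - he
    simp only at he
    have := List.append_inj' he rfl
    simp only [List.cons.injEq, and_true] at this
    rw [this.1, this.2]

lemma rtP_append_le (hR : RTF S Γ z o) (v u : List (Fin V)) :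
    (rtP S (v ++ u)).card ≤ (rtP S v).card * H ^ u.length := by
  induction u using List.reverseRecOn with
  | nil => simp
  | append_singleton u β ih =>
    rw [← List.append_assoc]
    refine (rtP_snoc_le hR _ _).trans ?_
    simp only [List.length_append, List.length_singleton, pow_succ, ← mul_assoc]
    exact Nat.mul_le_mul_right _ ih

lemma rtP_append_ge (hR : RTF S Γ z o) (v u : List (Fin V)) :
    (rtP S v).card * 2 ^ u.length ≤ (rtP S (v ++ u)).card := by
  induction u using List.reverseRecOn with
  | nil => simp
  | append_singleton u β ih =>
    rw [← List.append_assoc]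
    refine le_trans ?_ (rtP_snoc_ge hR _ _)
    simp only [List.length_append, List.length_singleton, pow_succ, ← mul_assoc]
    exact Nat.mul_le_mul_right _ ih

lemma rtP_le (hR : RTF S Γ z o) (u : List (Fin V)) : (rtP S u).card ≤ H ^ u.length := by
  simpa [rtP_nil hR] using rtP_append_le hR [] u

lemma rtP_ge (hR : RTF S Γ z o) (u : List (Fin V)) : 2 ^ u.length ≤ (rtP S u).card := by
  simpa [rtP_nil hR] using rtP_append_ge hR [] u

/-- ancestors -/
lemma rt_take (hR : RTF S Γ z o) (v : List (Fin V)) : ∀ (h : List (Fin H)), (h, v) ∈ S →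
    ∀ j, (h.take j, v.take j) ∈ S := by
  induction v using List.reverseRecOn with
  | nil =>
    intro h hx j
    have : h = [] := List.length_eq_zero_iff.1 (hR.len _ _ hx)
    subst this
    simpa using hx
  | append_singleton v β ih =>
    intro h hx j
    obtain ⟨h', α, rfl⟩ := rt_snoc hR hx
    have hl := hR.len _ _ hx
    simp only [List.length_append, List.length_singleton] at hl
    by_cases hj : j ≤ v.length
    · rw [List.take_append_of_le_length (by omega), List.take_append_of_le_length hj]
      exact ih h' (hR.par _ _ _ _ hx) j
    · rw [List.take_of_length_le (by simp; omega), List.take_of_length_le (by simp; omega)]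
      exact hx

lemma rt_take_adj (hR : RTF S Γ z o) {h : List (Fin H)} {v : List (Fin V)} (hx : (h, v) ∈ S)
    {j : ℕ} (hj : j < v.length) :
    Γ.Adj (h.take j, v.take j) (h.take (j + 1), v.take (j + 1)) := by
  have hl := hR.len _ _ hx
  have h1 := rt_take hR v h hx (j + 1)
  rw [← List.take_concat_get' h j (by omega), ← List.take_concat_get' v j hj] at h1 ⊢
  exact hR.adj _ _ _ _ h1

lemma rt_zeros (hR : RTF S Γ z o) {h : List (Fin H)} {v : List (Fin V)} (hx : (h, v) ∈ S)
    (u : List (Fin V)) : (h ++ List.replicate u.length z, v ++ u) ∈ S := by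
  induction u using List.reverseRecOn with
  | nil => simpa using hx
  | append_singleton u β ih =>
    rw [← List.append_assoc, List.length_append, List.length_singleton, List.replicate_succ',
      ← List.append_assoc]
    exact hR.chz _ _ _ ih

/-- sums along vertical paths -/
lemma rt_seq_path {α : Type*} [DecidableEq α] (F N : α → ℝ) (hN : ∀ x, 0 ≤ N x) (g : ℕ → α)
    (n : ℕ) (hinj : Set.InjOn g (Finset.range (n + 1) : Finset ℕ))
    (hg : ∀ i < n, |F (g i) - F (g (i + 1))| ≤ N (g i)) :
    |F (g 0) - F (g n)| ≤ ∑ y ∈ (Finset.range (n + 1)).image g, N y := by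
  rw [Finset.sum_image hinj, Finset.sum_range_succ]
  have : |F (g 0) - F (g n)| ≤ ∑ i ∈ Finset.range n, N (g i) := by
    clear hinj
    induction n with
    | zero => simp
    | succ n ih =>
      rw [Finset.sum_range_succ]
      have h1 := ih fun i hi => hg i (by omega)
      have h2 := hg n (by omega)
      have h3 := abs_sub_le (F (g 0)) (F (g n)) (F (g (n + 1)))
      linarith
  linarith [hN (g n)]

/-- sums along a finite linear order -/
lemma rt_lin_path {α : Type*} [LinearOrder α] (F N : α → ℝ) (hN : ∀ x, 0 ≤ N x) (P : Finset α)
    (hP : ∀ a ∈ P, ∀ b ∈ P, a < b → (¬∃ c ∈ P, a < c ∧ c < b) → |F a - F b| ≤ N a) :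
    ∀ a ∈ P, ∀ b ∈ P, |F a - F b| ≤ ∑ y ∈ P, N y := by
  have key : ∀ n : ℕ, ∀ a ∈ P, ∀ b ∈ P, a ≤ b → (P.filter fun c => a ≤ c ∧ c < b).card = n →
      |F a - F b| ≤ ∑ y ∈ P.filter fun c => a ≤ c ∧ c < b, N y := by
    intro n
    induction n with
    | zero =>
      intro a ha b hb hab h0
      rcases hab.eq_or_lt with rfl | hlt
      · simpa using Finset.sum_nonneg fun y _ => hN y
      · exfalso
        rw [Finset.card_eq_zero] at h0
        have : a ∈ P.filter fun c => a ≤ c ∧ c < b := by simp [ha, hlt]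
        rw [h0] at this
        simp at this
    | succ n ih =>
      intro a ha b hb hab h0
      rcases hab.eq_or_lt with rfl | hlt
      · simpa using Finset.sum_nonneg fun y _ => hN y
      · obtain ⟨y, hy, hay, hmin⟩ := Finset.exists_next_right ⟨b, hb, hlt⟩
        have hyb : y ≤ b := hmin b hb hlt
        have e : (P.filter fun c => a ≤ c ∧ c < b) =
            insert a (P.filter fun c => y ≤ c ∧ c < b) := by
          ext c
          simp only [Finset.mem_filter, Finset.mem_insert]
          constructor
          · rintro ⟨hc, hac, hcb⟩
            rcases hac.eq_or_lt with rfl | h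
            · exact Or.inl rfl
            · exact Or.inr ⟨hc, hmin c hc h, hcb⟩
          · rintro (rfl | ⟨hc, hyc, hcb⟩)
            · exact ⟨ha, le_rfl, hlt⟩
            · exact ⟨hc, hay.le.trans hyc, hcb⟩
        have hn : a ∉ P.filter fun c => y ≤ c ∧ c < b := by
          simp only [Finset.mem_filter, not_and]
          intro _ h
          exact absurd h (not_le.2 hay)
        rw [e, Finset.card_insert_of_notMem hn] at h0
        rw [e, Finset.sum_insert hn]
        have h1 := ih y hy b hb hyb (by omega)
        have h2 := hP a ha y hy hay (by
          rintro ⟨c, hc, hac, hcy⟩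
          exact absurd (hmin c hc hac) (not_le.2 hcy))
        have h3 := abs_sub_le (F a) (F y) (F b)
        linarith
  have key2 : ∀ a ∈ P, ∀ b ∈ P, a ≤ b → |F a - F b| ≤ ∑ y ∈ P, N y := by
    intro a ha b hb hab
    refine (key _ a ha b hb hab rfl).trans ?_
    exact Finset.sum_le_sum_of_subset_of_nonneg (Finset.filter_subset _ _) fun _ _ _ => hN _
  intro a ha b hb
  rcases le_total a b with h | h
  · exact key2 a ha b hb h
  · rw [abs_sub_comm]; exact key2 b hb a ha h

end Comb

section Tree

variable {H V : ℕ} {S : Set (RTVert H V)} {Γ : SimpleGraph (RTVert H V)} {z o : Fin H}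

/-- words extending `v₀` all of whose proper prefixes (extending `v₀`) have short paths -/
def rtTree (S : Set (RTVert H V)) (v₀ : List (Fin V)) (T : ℕ) (v : List (Fin V)) : Prop :=
  v₀ <+: v ∧ ∀ j, v₀.length ≤ j → j < v.length → (rtP S (v.take j)).card < T

open Classical in
/-- number of letters to be appended to reach a long path -/
noncomputable def rtJ (S : Set (RTVert H V)) (T : ℕ) (β : Fin V) (v : List (Fin V)) : ℕ :=
  if h : ∃ j, T ≤ (rtP S (v ++ List.replicate j β)).card then Nat.find h else 0

lemma rtJ_ex (hR : RTF S Γ z o) (T : ℕ) (β : Fin V) (v : List (Fin V)) :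
    ∃ j, T ≤ (rtP S (v ++ List.replicate j β)).card := by
  refine ⟨T, ?_⟩
  refine le_trans ?_ (rtP_ge hR _)
  refine (Nat.lt_two_pow_self).le.trans (Nat.pow_le_pow_right (by norm_num) ?_)
  simp

lemma rtJ_spec (hR : RTF S Γ z o) (T : ℕ) (β : Fin V) (v : List (Fin V)) :
    T ≤ (rtP S (v ++ List.replicate (rtJ S T β v) β)).card := by
  classical
  unfold rtJ
  rw [dif_pos (rtJ_ex hR T β v)]
  convert Nat.find_spec (rtJ_ex hR T β v)

lemma rtJ_min (hR : RTF S Γ z o) (T : ℕ) (β : Fin V) (v : List (Fin V)) (i : ℕ)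
    (hi : i < rtJ S T β v) : (rtP S (v ++ List.replicate i β)).card < T := by
  classical
  unfold rtJ at hi
  rw [dif_pos (rtJ_ex hR T β v)] at hi
  have := (Nat.lt_find_iff (rtJ_ex hR T β v) i).1 (by convert hi) i le_rfl
  omega

lemma rtTree_app (hR : RTF S Γ z o) {v₀ : List (Fin V)} {T : ℕ} (β : Fin V) {v : List (Fin V)}
    (hv : rtTree S v₀ T v) {i : ℕ} (hi : i ≤ rtJ S T β v) :
    rtTree S v₀ T (v ++ List.replicate i β) := by
  refine ⟨hv.1.trans (List.prefix_append _ _), ?_⟩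
  intro j hj hj2
  simp only [List.length_append, List.length_replicate] at hj2
  by_cases h : j < v.length
  · rw [List.take_append_of_le_length h.le]
    exact hv.2 j hj h
  · rw [List.take_append, List.take_of_length_le (by omega), List.take_replicate]
    exact rtJ_min hR T β v _ (by omega)

lemma rtTree_take {v₀ : List (Fin V)} {T : ℕ} {v : List (Fin V)}
    (hv : rtTree S v₀ T v) {i : ℕ} (hi : v₀.length ≤ i) :
    rtTree S v₀ T (v.take i) := by
  refine ⟨?_, ?_⟩
  · rw [List.prefix_take_iff]
    exact ⟨hv.1, hi⟩
  · intro j hj hj2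
    rw [List.length_take] at hj2
    rw [List.take_take, min_eq_left (by omega)]
    exact hv.2 j hj (by omega)

/-- path length in the tree -/
lemma rtTree_card (hR : RTF S Γ z o) {v₀ : List (Fin V)} {T : ℕ} (hH : 1 ≤ H)
    (hT : (rtP S v₀).card ≤ T) {v : List (Fin V)} (hv : rtTree S v₀ T v) :
    (rtP S v).card ≤ H * T := by
  obtain ⟨⟨u, rfl⟩, h2⟩ := hv
  rcases List.eq_nil_or_concat u with rfl | ⟨u, β, rfl⟩
  · rw [List.append_nil]
    nlinarith
  · have h3 := h2 (v₀.length + u.length) (by omega) (by simp)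
    rw [List.concat_eq_append, ← List.append_assoc, List.take_append_of_le_length (by simp),
      List.take_of_length_le (by simp)] at h3
    rw [List.concat_eq_append, ← List.append_assoc]
    refine (rtP_snoc_le hR _ _).trans ?_
    rw [mul_comm]
    exact Nat.mul_le_mul_left _ h3.le

/-- depth of the tree -/
lemma rtTree_depth (hR : RTF S Γ z o) {v₀ : List (Fin V)} {n : ℕ} 
    {v : List (Fin V)} (hv : rtTree S v₀ ((rtP S v₀).card * H ^ n) v) :
    v.length ≤ v₀.length + H * n := by
  obtain ⟨⟨u, rfl⟩, h2⟩ := hv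
  rcases List.eq_nil_or_concat u with rfl | ⟨u, β, rfl⟩
  · simp
  · have h3 := h2 (v₀.length + u.length) (by omega) (by simp)
    rw [List.concat_eq_append, ← List.append_assoc, List.take_append_of_le_length (by simp),
      List.take_of_length_le (by simp)] at h3
    have h4 := (rtP_append_ge hR v₀ u).trans_lt h3
    have h5 : 2 ^ u.length < H ^ n := lt_of_mul_lt_mul_left h4 (Nat.zero_le _)
    have h6 : H ^ n ≤ 2 ^ (H * n) := by
      rw [pow_mul]
      exact Nat.pow_le_pow_left Nat.lt_two_pow_self.le n
    have h7 := (Nat.pow_lt_pow_iff_right (by norm_num : 1 < 2)).1 (h5.trans_le h6)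
    simp
    omega

open Classical in
/-- the finite vertex set -/
noncomputable def rtY (S : Set (RTVert H V)) (v₀ : List (Fin V)) (n : ℕ) : Finset (RTVert H V) :=
  (((List.finite_length_le (Fin H) (v₀.length + H * n)).toFinset) ×ˢ
    ((List.finite_length_le (Fin V) (v₀.length + H * n)).toFinset)).filter
    fun x => x ∈ S ∧ rtTree S v₀ ((rtP S v₀).card * H ^ n) x.2

lemma mem_rtY (hR : RTF S Γ z o) {v₀ : List (Fin V)} {n : ℕ} {x : RTVert H V} :
    x ∈ rtY S v₀ n ↔ x ∈ S ∧ rtTree S v₀ ((rtP S v₀).card * H ^ n) x.2 := by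
  unfold rtY
  simp only [Finset.mem_filter, Finset.mem_product, Set.Finite.mem_toFinset, Set.mem_ofPred_eq,
    and_iff_right_iff_imp]
  rintro ⟨h1, h2⟩
  have h3 := rtTree_depth hR h2
  have h4 := hR.len x.1 x.2 h1
  omega

/-- size of the vertex set -/
lemma rtY_card (hR : RTF S Γ z o) (hH : 2 ≤ H) (v₀ : List (Fin V)) (n : ℕ) (β : Fin V) :
    V ^ n * ((rtP S v₀).card * H ^ n) ≤ (rtY S v₀ n).card := by
  classical
  set T := (rtP S v₀).card * H ^ n with hT
  let w : (Fin n → Fin V) → List (Fin V) := fun u => v₀ ++ List.ofFn u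
  let t : (Fin n → Fin V) → List (Fin V) := fun u => w u ++ List.replicate (rtJ S T β (w u)) β
  have hL : 0 < (rtP S v₀).card := lt_of_lt_of_le (by positivity) (rtP_ge hR v₀)
  have hw : ∀ u, rtTree S v₀ T (w u) := by
    intro u
    refine ⟨List.prefix_append _ _, ?_⟩
    intro j hj hj2
    simp only [w, List.length_append, List.length_ofFn] at hj2
    rw [List.take_append, List.take_of_length_le hj]
    refine (rtP_append_le hR _ _).trans_lt ?_
    rw [hT]
    refine Nat.mul_lt_mul_of_pos_left (Nat.pow_lt_pow_right (by omega) ?_) hL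
    simp
    omega
  have h1 : V ^ n * T ≤ ((Finset.univ : Finset (Fin n → Fin V)).sigma fun u => rtP S (t u)).card := by
    rw [Finset.card_sigma]
    refine le_trans (le_of_eq ?_) (Finset.card_nsmul_le_sum _ _ T fun u _ => rtJ_spec hR T β (w u))
    simp
  refine h1.trans ?_
  apply Finset.card_le_card_of_injOn (fun q => (q.2, t q.1))
  · rintro ⟨u, h⟩ hq
    simp only [Finset.coe_sigma, Set.mem_sigma_iff, Finset.mem_coe, mem_rtP hR] at hq
    simp only [Finset.mem_coe, mem_rtY hR]
    exact ⟨hq.2, rtTree_app hR β (hw u) le_rfl⟩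
  · rintro ⟨u, h⟩ - ⟨u', h'⟩ - he
    simp only [Prod.mk.injEq] at he
    obtain ⟨rfl, he⟩ := he
    have e1 := congrArg (List.take (v₀.length + n)) he
    have e2 : ∀ u, (t u).take (v₀.length + n) = w u := by
      intro u
      simp only [t]
      rw [List.take_append_of_le_length (by simp [w]), List.take_of_length_le (by simp [w])]
    rw [e2, e2] at e1
    have e3 := List.ofFn_injective (List.append_cancel_left e1)
    subst e3
    rfl

/-- The Poincaré inequality. -/
lemma rt_poincare (hR : RTF S Γ z o) (hH : 2 ≤ H) (v₀ : List (Fin V)) (n : ℕ) (β : Fin V)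
    (p : ℝ) (hp : 1 ≤ p) (F N : RTVert H V → ℝ) (hN : ∀ x, 0 ≤ N x)
    (hF : ∀ x ∈ rtY S v₀ n, ∀ y ∈ rtY S v₀ n, Γ.Adj x y → |F x - F y| ≤ N x) :
    ∃ c : ℝ, ∑ x ∈ rtY S v₀ n, |F x - c| ^ p ≤
      3 ^ (p - 1) * (((H * n + 1 : ℕ) : ℝ) ^ p + ((H * n + 1 : ℕ) : ℝ) *
          ((H * ((rtP S v₀).card * H ^ n) : ℕ) : ℝ) ^ p +
        ((H * n + 1 : ℕ) : ℝ) ^ (p - 1) * ((rtY S v₀ n).card / (rtP S v₀).card)) *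
        ∑ y ∈ rtY S v₀ n, N y ^ p := by
  classical
  set T := (rtP S v₀).card * H ^ n with hT
  have hL : 0 < (rtP S v₀).card := lt_of_lt_of_le (by positivity) (rtP_ge hR v₀)
  have hT0 : 0 < T := by positivity
  have hLT : (rtP S v₀).card ≤ T := Nat.le_mul_of_pos_right _ (by positivity)
  set m := v₀.length with hm
  let J := rtJ S T β
  let t : List (Fin V) → List (Fin V) := fun v => v ++ List.replicate (J v) β
  let I : Finset (RTVert H V) := (rtP S v₀).image fun h => (h, v₀)
  have hIc : I.card = (rtP S v₀).card :=
    Finset.card_image_of_injective _ fun a b h => (Prod.mk.injEq _ _ _ _ ▸ h).1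
  let gA : RTVert H V → ℕ → RTVert H V :=
    fun x i => (x.1 ++ List.replicate i z, x.2 ++ List.replicate i β)
  let A : RTVert H V → Finset (RTVert H V) := fun x => (Finset.range (J x.2 + 1)).image (gA x)
  let B : RTVert H V → Finset (RTVert H V) := fun x => (rtP S (t x.2)).image fun h => (h, t x.2)
  let gC : RTVert H V → RTVert H V → ℕ → RTVert H V := fun x i d =>
    ((i.1 ++ List.replicate ((t x.2).length - m) z).take (m + d), (t x.2).take (m + d))
  let C : RTVert H V → RTVert H V → Finset (RTVert H V) := fun x i =>
    (Finset.range ((t x.2).length - m + 1)).image (gC x i)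
  -- basic facts
  have hmem : ∀ {x : RTVert H V}, x ∈ rtY S v₀ n ↔ x ∈ S ∧ rtTree S v₀ T x.2 := mem_rtY hR
  have htree : ∀ x ∈ rtY S v₀ n, rtTree S v₀ T (t x.2) := fun x hx =>
    rtTree_app hR β (hmem.1 hx).2 le_rfl
  have hlen : ∀ x ∈ rtY S v₀ n, x.1.length = x.2.length := fun x hx => hR.len _ _ (hmem.1 hx).1
  have hm1 : ∀ x ∈ rtY S v₀ n, m ≤ x.2.length := fun x hx => (hmem.1 hx).2.1.length_le
  have hm2 : ∀ x ∈ rtY S v₀ n, x.2.length ≤ m + H * n := fun x hx => rtTree_depth hR (hmem.1 hx).2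
  have htl : ∀ x ∈ rtY S v₀ n, (t x.2).length ≤ m + H * n := fun x hx =>
    rtTree_depth hR (htree x hx)
  have htl2 : ∀ v, (t v).length = v.length + J v := fun v => by simp [t]
  have hgA : ∀ x ∈ rtY S v₀ n, ∀ i ≤ J x.2, gA x i ∈ rtY S v₀ n := by
    intro x hx i hi
    rw [hmem]
    refine ⟨?_, rtTree_app hR β (hmem.1 hx).2 hi⟩
    simpa using rt_zeros hR (hmem.1 hx).1 (List.replicate i β)
  have hgAt : ∀ x ∈ rtY S v₀ n, ∀ i, ((gA x i).1.take x.2.length, (gA x i).2.take x.2.length) = x := by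
    intro x hx i
    have := hlen x hx
    ext1
    · simp only [gA]
      rw [← this]
      simp
    · simp [gA]
  have hend : ∀ x ∈ rtY S v₀ n, ∀ i ∈ I,
      (i.1 ++ List.replicate ((t x.2).length - m) z, t x.2) ∈ S := by
    intro x hx i hi
    simp only [I, Finset.mem_image, mem_rtP hR] at hi
    obtain ⟨h, hh, rfl⟩ := hi
    obtain ⟨u, hu⟩ := (htree x hx).1
    have h2 := rt_zeros hR hh u
    rw [hu] at h2
    rw [← hu, List.length_append, ← hm, Nat.add_sub_cancel_left, hu]
    exact h2
  have hgC : ∀ x ∈ rtY S v₀ n, ∀ i ∈ I, ∀ d, gC x i d ∈ rtY S v₀ n := by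
    intro x hx i hi d
    rw [hmem]
    exact ⟨rt_take hR _ _ (hend x hx i hi) _, rtTree_take (htree x hx) (by omega)⟩
  have hIl : ∀ i ∈ I, i.1.length = m ∧ i.2 = v₀ := by
    intro i hi
    simp only [I, Finset.mem_image, mem_rtP hR] at hi
    obtain ⟨h, hh, rfl⟩ := hi
    exact ⟨hR.len _ _ hh, rfl⟩
  have hres := rt_core (rtY S v₀ n) I F N hN ?_ A B C p hp (H * n + 1) (H * T) (by omega)
    (Nat.mul_pos (by omega) hT0) ?_ ?_ ?_ ?_ ?_ ?_ ?_ ?_ ?_ ?_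
  · rw [hIc] at hres
    exact hres
  · rw [← Finset.card_pos, hIc]; exact hL
  · intro x hx y hy
    simp only [A, Finset.mem_image, Finset.mem_range] at hy
    obtain ⟨i, hi, rfl⟩ := hy
    exact hgA x hx i (by omega)
  · intro x hx y hy
    simp only [B, Finset.mem_image, mem_rtP hR] at hy
    obtain ⟨h, hh, rfl⟩ := hy
    exact hmem.2 ⟨hh, htree x hx⟩
  · intro x hx i hi y hy
    simp only [C, Finset.mem_image] at hy
    obtain ⟨d, -, rfl⟩ := hy
    exact hgC x hx i hi d
  · intro x hx
    refine Finset.card_image_le.trans ?_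
    have := htl x hx
    have := htl2 x.2
    have := hm1 x hx
    simp
    omega
  · intro x hx
    exact Finset.card_image_le.trans (rtTree_card hR (by omega) hLT (htree x hx))
  · intro x hx i hi
    refine Finset.card_image_le.trans ?_
    have := htl x hx
    simp
    omega
  · intro y hy
    have : ((Finset.Icc m (m + H * n)).card) = H * n + 1 := by simp; omega
    rw [← this]
    apply Finset.card_le_card_of_injOn (fun x => x.2.length)
    · intro x hx
      simp only [Finset.coe_filter, Set.mem_ofPred_eq] at hx
      simp only [Finset.coe_Icc, Set.mem_Icc]
      exact ⟨hm1 x hx.1, hm2 x hx.1⟩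
    · intro x hx x' hx' he
      simp only [Finset.coe_filter, Set.mem_ofPred_eq, A, Finset.mem_image] at hx hx' he
      obtain ⟨hx, i, -, hi⟩ := hx
      obtain ⟨hx', i', -, hi'⟩ := hx'
      rw [← hgAt x hx i, ← hgAt x' hx' i', hi, hi', he]
  · intro y hy
    have : ((Finset.Icc m (m + H * n)) ×ˢ rtP S y.2).card ≤ (H * n + 1) * (H * T) := by
      rw [Finset.card_product]
      refine Nat.mul_le_mul (by simp; omega) (rtTree_card hR (by omega) hLT (hmem.1 hy).2)
    refine le_trans ?_ this
    have hBy : ∀ x, y ∈ B x → y.2 = t x.2 := by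
      intro x hx
      simp only [B, Finset.mem_image] at hx
      obtain ⟨h, -, rfl⟩ := hx
      rfl
    apply Finset.card_le_card_of_injOn (fun x => (x.2.length, (gA x (J x.2)).1))
    · intro x hx
      simp only [Finset.coe_filter, Set.mem_ofPred_eq] at hx
      simp only [Finset.coe_product, Set.mem_prod, Finset.coe_Icc, Set.mem_Icc, Finset.mem_coe,
        mem_rtP hR]
      refine ⟨⟨hm1 x hx.1, hm2 x hx.1⟩, ?_⟩
      rw [hBy x hx.2]
      exact (hmem.1 (hgA x hx.1 _ le_rfl)).1
    · intro x hx x' hx' he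
      simp only [Finset.coe_filter, Set.mem_ofPred_eq] at hx hx'
      simp only [Prod.mk.injEq] at he
      have e : gA x (J x.2) = gA x' (J x'.2) := by
        ext1
        · exact he.2
        · exact (hBy x hx.2).symm.trans (hBy x' hx'.2)
      rw [← hgAt x hx.1 (J x.2), ← hgAt x' hx'.1 (J x'.2), e, he.1]
  · intro x hx y hy
    rw [Finset.card_le_one]
    have : ∀ i ∈ I, y ∈ C x i → i = (y.1.take m, v₀) := by
      intro i hi hyi
      simp only [C, Finset.mem_image] at hyi
      obtain ⟨d, -, rfl⟩ := hyi
      obtain ⟨h1, h2⟩ := hIl i hi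
      ext1
      · simp only [gC]
        rw [List.take_take, min_eq_left (by omega), List.take_append_of_le_length h1.ge,
          List.take_of_length_le h1.le]
      · exact h2
    intro i hi i' hi'
    simp only [Finset.mem_filter] at hi hi'
    rw [this i hi.1 hi.2, this i' hi'.1 hi'.2]
  · intro x hx i hi
    have q1 : |F x - F (gA x (J x.2))| ≤ ∑ y ∈ A x, N y := by
      have := rt_seq_path F N hN (gA x) (J x.2) ?_ ?_
      · have hg0 : gA x 0 = x := by simp [gA]
        rw [hg0] at this
        exact this
      · intro a _ b _ hab
        have := congrArg (fun q : RTVert H V => q.2.length) hab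
        simpa [gA] using this
      · intro j hj
        have h1 := hgA x hx (j + 1) (by omega)
        refine hF _ (hgA x hx j (by omega)) _ h1 ?_
        have h2 := (hmem.1 h1).1
        simp only [gA, List.replicate_succ', ← List.append_assoc] at h2 ⊢
        exact hR.adj _ _ _ _ h2
    have hgCl : gC x i ((t x.2).length - m) =
        (i.1 ++ List.replicate ((t x.2).length - m) z, t x.2) := by
      have := (htree x hx).1.length_le
      have := (hIl i hi).1
      ext1
      · simp only [gC]
        rw [List.take_of_length_le (by simp; omega)]
      · simp only [gC]
        rw [List.take_of_length_le (by omega)]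
    have q2 : |F (gA x (J x.2)) - F (gC x i ((t x.2).length - m))| ≤ ∑ y ∈ B x, N y := by
      have h1 := rt_lin_path (fun h => F (h, t x.2)) (fun h => N (h, t x.2)) (fun h => hN _)
        (rtP S (t x.2)) ?_ (gA x (J x.2)).1 ?_ (gC x i ((t x.2).length - m)).1 ?_
      · simp only [B]
        rw [Finset.sum_image (fun a _ b _ h => (Prod.mk.injEq _ _ _ _ ▸ h).1)]
        rw [hgCl] at h1 ⊢
        exact h1
      · intro a ha b hb hab hno
        rw [mem_rtP hR] at ha hb
        refine hF _ (hmem.2 ⟨ha, htree x hx⟩) _ (hmem.2 ⟨hb, htree x hx⟩) (hR.hor _ _ _ ha hb hab ?_)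
        rintro ⟨w, hw, h2⟩
        exact hno ⟨w, (mem_rtP hR).2 hw, h2⟩
      · rw [mem_rtP hR]
        exact (hmem.1 (hgA x hx _ le_rfl)).1
      · rw [mem_rtP hR, hgCl]
        exact hend x hx i hi
    have hgC0 : gC x i 0 = i := by
      obtain ⟨h1, h2⟩ := hIl i hi
      ext1
      · simp only [gC, add_zero]
        rw [List.take_append_of_le_length h1.ge, List.take_of_length_le h1.le]
      · simp only [gC, add_zero]
        rw [h2, hm]
        exact (List.prefix_iff_eq_take.1 (htree x hx).1).symm
    have q3 : |F (gC x i ((t x.2).length - m)) - F i| ≤ ∑ y ∈ C x i, N y := by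
      have := rt_seq_path F N hN (gC x i) ((t x.2).length - m) ?_ ?_
      · rw [hgC0, abs_sub_comm] at this
        exact this
      · intro a ha b hb hab
        have h1 := congrArg (fun q : RTVert H V => q.2.length) hab
        simp only [Finset.coe_range, Set.mem_Iio] at ha hb
        simp only [gC, List.length_take] at h1
        have := (htree x hx).1.length_le
        omega
      · intro j hj
        refine hF _ (hgC x hx i hi j) _ (hgC x hx i hi (j + 1)) ?_
        exact rt_take_adj hR (hend x hx i hi) (by omega)
    have q4 := abs_sub_le (F x) (F (gA x (J x.2))) (F i)
    have q5 := abs_sub_le (F (gA x (J x.2))) (F (gC x i ((t x.2).length - m))) (F i)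
    linarith

end Tree

set_option maxHeartbeats 2000000 in
/-- Let `Γ` be a round tree graph with horizontal branching in `[2,H]`
and vertical branching `V ≥ 2`, and `Q = 1 + log V / log H`.  For every `1 ≤ p < Q`
there is no `C > 0` with `Λ^p_Γ(r) ≤ C (Cr+C)^(1-1/p) + C` for all `r ≥ 1`; i.e. the
set `{p : Λ^p_Γ(r) ≲ r^(1-1/p)}` is contained in `[Q,∞)`, so
`p_Λ(Γ) ≥ 1 + log V / log H`. -/
theorem roundTree_profile_not_dominated (H V : ℕ) (hH : 2 ≤ H) (hV : 2 ≤ V)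
    (S : Set (RTVert H V)) (Γ : SimpleGraph (RTVert H V))
    (hΓ : IsRoundTreeGraph H V S Γ)
    (p : ℝ) (hp : 1 ≤ p) (hpQ : p < 1 + Real.log V / Real.log H) :
    ¬∃ C > 0, ∀ r : ℝ, 1 ≤ r →
      poincareProfile Γ p r ≤ C * (C * r + C) ^ (1 - 1 / p) + C := by
  rintro ⟨C₀, hC₀, hdom⟩
  have hR := rtf_of hH S Γ hΓ
  have hp0 : 0 < p := by linarith
  let β : Fin V := ⟨0, by omega⟩
  have hHR : (2 : ℝ) ≤ H := by exact_mod_cast hH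
  have hVR : (2 : ℝ) ≤ V := by exact_mod_cast hV
  have hH0 : (0 : ℝ) < H := by linarith
  have hV0 : (0 : ℝ) < V := by linarith
  -- the ratio
  have hρ : (H : ℝ) ^ (p - 1) / V < 1 := by
    rw [div_lt_one hV0]
    have hlog : 0 < Real.log H := Real.log_pos (by linarith)
    have h1 : (p - 1) * Real.log H < Real.log V := by
      rw [← lt_div_iff₀ hlog]; linarith
    rw [← Real.log_lt_log_iff (by positivity) hV0, Real.log_rpow hH0]
    exact h1
  obtain ⟨A, hA⟩ := exists_pow_lt_of_lt_one
    (by positivity : (0 : ℝ) < ((H : ℝ) ^ (p - 1))⁻¹) hρ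
  set ρ : ℝ := (H : ℝ) ^ (p - 1) / V with hρdef
  have hρ0 : 0 < ρ := by positivity
  set σ : ℝ := (H : ℝ) ^ (p - 1) * ρ ^ A with hσdef
  have hσ0 : 0 < σ := by positivity
  have hσ1 : σ < 1 := by
    rw [hσdef, ← lt_inv_mul_iff₀ (by positivity), mul_one]
    exact hA
  set D : ℝ := (2 ^ p * 2) * (C₀ * (2 * C₀) ^ (1 - 1 / p) + C₀) ^ p * 3 ^ (p - 1) with hD
  have hD0 : 0 < D := by positivity
  set q : ℕ := ⌈p⌉₊ with hq
  have hpq : p ≤ q := Nat.le_ceil p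
  set B : ℝ := ((H * A + 1 : ℕ) : ℝ) with hB
  have hB1 : 1 ≤ B := by rw [hB]; exact_mod_cast (by omega : 1 ≤ H * A + 1)
  have key : ∀ m : ℕ, 1 ≤ m → 1 ≤ D * (2 * B ^ q * ((m : ℝ) ^ q * (1 / 2) ^ m) +
      B * H ^ p * ((m : ℝ) ^ 1 * σ ^ m)) := by
    intro m hm
    have hmR : (1 : ℝ) ≤ m := by exact_mod_cast hm
    set v₀ : List (Fin V) := List.replicate m β with hv₀
    set n := A * m with hn
    have hL1 : 2 ^ m ≤ (rtP S v₀).card := by simpa [hv₀] using rtP_ge hR v₀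
    have hL2 : (rtP S v₀).card ≤ H ^ m := by simpa [hv₀] using rtP_le hR v₀
    have hsN := rtY_card hR hH v₀ n β
    have hs2 : (rtP S v₀).card ≤ (rtY S v₀ n).card := by
      refine le_trans ?_ hsN
      have h1 : 1 ≤ V ^ n := Nat.one_le_pow _ _ (by omega)
      have h2 : 1 ≤ H ^ n := Nat.one_le_pow _ _ (by omega)
      calc (rtP S v₀).card = 1 * ((rtP S v₀).card * 1) := by simp
        _ ≤ _ := Nat.mul_le_mul h1 (Nat.mul_le_mul_left _ h2)
    have hs1 : 1 < (rtY S v₀ n).card := by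
      have : 2 ^ 1 ≤ 2 ^ m := Nat.pow_le_pow_right (by norm_num) hm
      omega
    have hpoin := rt_poincare (Γ := Γ) hR hH v₀ n β p hp
    set L : ℕ := (rtP S v₀).card with hLdef
    set s := rtY S v₀ n with hsdef
    set a : ℕ := H * n + 1 with ha
    set b : ℕ := H * (L * H ^ n) with hb
    have hL1R : (2 : ℝ) ^ m ≤ L := by exact_mod_cast hL1
    have hL2R : (L : ℝ) ≤ H ^ m := by exact_mod_cast hL2
    have hL0 : (0 : ℝ) < L := lt_of_lt_of_le (by positivity) hL1R
    have hs0 : (0 : ℝ) < s.card := by exact_mod_cast (by omega : 0 < s.card)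
    have hsL : (L : ℝ) ≤ s.card := by exact_mod_cast hs2
    have ha1 : (1 : ℝ) ≤ a := by exact_mod_cast (by omega : 1 ≤ a)
    have haB : (a : ℝ) ≤ B * m := by
      rw [ha, hB, hn]
      push_cast
      nlinarith
    have hK0 : 0 < 3 ^ (p - 1) * ((a : ℝ) ^ p + a * (b : ℝ) ^ p +
        (a : ℝ) ^ (p - 1) * (s.card / L)) := by positivity
    have hmain := rt_profile_bound Γ p hp C₀ hC₀ hdom s hs1 _ hK0 hpoin
    have hmain2 : (s.card : ℝ) ≤ D * ((a : ℝ) ^ p + a * (b : ℝ) ^ p +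
        (a : ℝ) ^ (p - 1) * (s.card / L)) := by
      rw [hD]; linarith
    have hap : (a : ℝ) ^ p ≤ B ^ q * (m : ℝ) ^ q := by
      calc (a : ℝ) ^ p ≤ (a : ℝ) ^ (q : ℝ) := Real.rpow_le_rpow_of_exponent_le ha1 hpq
        _ = (a : ℝ) ^ q := Real.rpow_natCast _ _
        _ ≤ (B * m) ^ q := by gcongr
        _ = _ := mul_pow _ _ _
    have hap1 : (a : ℝ) ^ (p - 1) ≤ (a : ℝ) ^ p :=
      Real.rpow_le_rpow_of_exponent_le ha1 (by linarith)
    have hLs : (s.card : ℝ) * (1 / 2) ^ m * L ≥ s.card := by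
      have : 1 ≤ (1 / 2 : ℝ) ^ m * L := by
        calc (1 : ℝ) = (1 / 2 : ℝ) ^ m * 2 ^ m := by rw [← mul_pow]; norm_num
          _ ≤ _ := by gcongr
      nlinarith
    have hsLL : (s.card : ℝ) / L ≤ s.card * (1 / 2) ^ m := by
      rw [div_le_iff₀ hL0]; exact hLs
    have hone : (1 : ℝ) ≤ s.card * (1 / 2) ^ m := by
      refine le_trans ?_ hsLL
      rw [le_div_iff₀ hL0]; linarith
    have t1 : (a : ℝ) ^ p ≤ s.card * (B ^ q * ((m : ℝ) ^ q * (1 / 2) ^ m)) := by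
      have h0 : 0 ≤ B ^ q * (m : ℝ) ^ q := by positivity
      have := mul_le_mul_of_nonneg_left hone h0
      linarith
    have t2 : (a : ℝ) ^ (p - 1) * (s.card / L) ≤
        s.card * (B ^ q * ((m : ℝ) ^ q * (1 / 2) ^ m)) := by
      calc _ ≤ (B ^ q * (m : ℝ) ^ q) * (s.card * (1 / 2) ^ m) :=
            mul_le_mul (hap1.trans hap) hsLL (by positivity) (by positivity)
        _ = _ := by ring
    have hsNR : (V : ℝ) ^ n * (L * H ^ n) ≤ s.card := by exact_mod_cast hsN
    have t3 : (b : ℝ) ^ p ≤ s.card * (H ^ p * σ ^ m) := by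
      have e1 : (b : ℝ) = H * (L * H ^ n) := by rw [hb]; push_cast; ring
      have e2 : ((L : ℝ) * H ^ n) ^ p = ((L : ℝ) * H ^ n) ^ (p - 1) * (L * H ^ n) := by
        rw [← Real.rpow_add_one (by positivity)]; simp
      have e3 : ((L : ℝ) * H ^ n) ^ (p - 1) ≤ σ ^ m * (V : ℝ) ^ n := by
        have hp1 : 0 ≤ p - 1 := by linarith
        have g1 : ∀ k : ℕ, ((H : ℝ) ^ k) ^ (p - 1) = ((H : ℝ) ^ (p - 1)) ^ k := by
          intro k
          rw [← Real.rpow_natCast, ← Real.rpow_natCast, ← Real.rpow_mul hH0.le,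
            ← Real.rpow_mul hH0.le, mul_comm]
        calc ((L : ℝ) * H ^ n) ^ (p - 1) ≤ ((H : ℝ) ^ m * H ^ n) ^ (p - 1) := by
              gcongr
          _ = ((H : ℝ) ^ (p - 1)) ^ m * ((H : ℝ) ^ (p - 1)) ^ n := by
              rw [Real.mul_rpow (by positivity) (by positivity), g1, g1]
          _ = σ ^ m * (V : ℝ) ^ n := by
              rw [hσdef, mul_pow, ← pow_mul, ← hn, hρdef, div_pow]
              field_simp
      rw [e1, Real.mul_rpow hH0.le (by positivity), e2]
      calc (H : ℝ) ^ p * (((L : ℝ) * H ^ n) ^ (p - 1) * (L * H ^ n))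
          ≤ (H : ℝ) ^ p * ((σ ^ m * (V : ℝ) ^ n) * (L * H ^ n)) := by gcongr
        _ = (H : ℝ) ^ p * σ ^ m * ((V : ℝ) ^ n * (L * H ^ n)) := by ring
        _ ≤ (H : ℝ) ^ p * σ ^ m * s.card := by gcongr
        _ = _ := by ring
    have t4 : (a : ℝ) * (b : ℝ) ^ p ≤ s.card * (B * H ^ p * ((m : ℝ) ^ 1 * σ ^ m)) := by
      calc _ ≤ (B * m) * (s.card * (H ^ p * σ ^ m)) := by gcongr
        _ = _ := by ring
    have t5 : (s.card : ℝ) * 1 ≤ s.card * (D * (2 * B ^ q * ((m : ℝ) ^ q * (1 / 2) ^ m) +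
        B * H ^ p * ((m : ℝ) ^ 1 * σ ^ m))) := by
      rw [mul_one]
      refine hmain2.trans ?_
      have := mul_le_mul_of_nonneg_left (add_le_add (add_le_add t1 t4) t2) hD0.le
      refine this.trans (le_of_eq ?_)
      ring
    exact le_of_mul_le_mul_left t5 hs0
  have l1 := tendsto_pow_const_mul_const_pow_of_abs_lt_one q (r := 1 / 2)
    (by rw [abs_of_pos] <;> norm_num)
  have l2 := tendsto_pow_const_mul_const_pow_of_abs_lt_one 1 (r := σ)
    (by rw [abs_of_pos hσ0]; exact hσ1)
  have l3 := ((l1.const_mul (2 * B ^ q)).add (l2.const_mul (B * H ^ p))).const_mul D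
  simp only [mul_zero, add_zero] at l3
  have l4 := (l3.eventually (gt_mem_nhds (by norm_num : (0 : ℝ) < 1))).and
    (Filter.eventually_ge_atTop 1)
  obtain ⟨m, hm1, hm2⟩ := l4.exists
  exact absurd (key m hm2) (not_le.2 hm1)
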